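/- (Proposition 2, Optimal importance proposals.) Assume the filtering consistency condition: for every 2 ≤ t ≤ T and Lebesgue-almost-every z_{1:t-1}, ∫ p(z_{1:t}|x_{1:t}) dz_t = p(z_{1:t-1}|x_{1:t-1}). If the proposals are chosen as q(z_1|x_1) = p(z_1|x_1) and, for t ≥ 2, q(z_t|z_{1:t-1}, x_{1:t}) = p(z_{1:t}|x_{1:t})/p(z_{1:t-1}|x_{1:t-1}) wherever p(z_{1:t-1}|x_{1:t-1}) > 0, then for every t the importance weight is constant, w_t ≡ p(x_t|x_{1:t-1}) Q_t^1-almost surely, and for every K ≥ 1 and every t, L_t^K = log p(x_t|x_{1:t-1}); consequently L_MCFO^K = log p(x_{1:T}) for every K, i.e., the bound is exact. -/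

import Mathlib

open MeasureTheory Filter

namespace MCFO

/-- The latent space at a single time step: `ℝ^dz`. -/
abbrev Zsp (dz : ℕ) : Type := Fin dz → ℝ

/-- Latent trajectories `z_{1:t+1}` (time is indexed from `0`, so index `t` corresponds to
the paper's time `t+1`). -/
abbrev Traj (dz t : ℕ) : Type := Fin (t + 1) → Zsp dz

/-- Importance weights `w_t`.  Here `pz t z` denotes the joint density `p(z_{1:t+1}, x_{1:t+1})`
(with the observations fixed) and `q t h ζ` the proposal density `q(z_{t+1} | z_{1:t}, x_{1:t+1})`.
Division by zero in `ℝ` yields `0`, so the weight is `0` wherever the denominator vanishes. -/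
noncomputable def w {dz : ℕ} (pz : (t : ℕ) → Traj dz t → ℝ)
    (q : (t : ℕ) → (Fin t → Zsp dz) → Zsp dz → ℝ) : (t : ℕ) → Traj dz t → ℝ
  | 0, z => pz 0 z / q 0 Fin.elim0 (z 0)
  | t + 1, z =>
      pz (t + 1) z / (pz t (Fin.init z) * q (t + 1) (Fin.init z) (z (Fin.last (t + 1))))

/-- Density of the single-trajectory sampling law `Q_t^1`:
`p(z_{1:t-1} | x_{1:t-1}) · q(z_t | z_{1:t-1}, x_{1:t})` (in the paper's indexing). -/
noncomputable def Qdens {dz : ℕ} (pz : (t : ℕ) → Traj dz t → ℝ) (pX : ℕ → ℝ)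
    (q : (t : ℕ) → (Fin t → Zsp dz) → Zsp dz → ℝ) : (t : ℕ) → Traj dz t → ℝ
  | 0, z => q 0 Fin.elim0 (z 0)
  | t + 1, z => pz t (Fin.init z) / pX t * q (t + 1) (Fin.init z) (z (Fin.last (t + 1)))

/-- The law `Q_t^1` of a single sampled trajectory. -/
noncomputable def Q1 {dz : ℕ} (pz : (t : ℕ) → Traj dz t → ℝ) (pX : ℕ → ℝ)
    (q : (t : ℕ) → (Fin t → Zsp dz) → Zsp dz → ℝ) (t : ℕ) : Measure (Traj dz t) :=
  volume.withDensity fun z => ENNReal.ofReal (Qdens pz pX q t z)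

/-- The law `Q_t^K` of `K` i.i.d. sampled trajectories. -/
noncomputable def QK {dz : ℕ} (pz : (t : ℕ) → Traj dz t → ℝ) (pX : ℕ → ℝ)
    (q : (t : ℕ) → (Fin t → Zsp dz) → Zsp dz → ℝ) (t K : ℕ) :
    Measure (Fin K → Traj dz t) :=
  Measure.pi fun _ => Q1 pz pX q t

/-- The estimator `R_t^K = (1/K) ∑_i w_t(z_{1:t}^i)`. -/
noncomputable def R {dz : ℕ} (pz : (t : ℕ) → Traj dz t → ℝ)
    (q : (t : ℕ) → (Fin t → Zsp dz) → Zsp dz → ℝ) (t K : ℕ)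
    (zs : Fin K → Traj dz t) : ℝ :=
  (∑ i, w pz q t (zs i)) / K

/-- The Monte Carlo objective `L_t^K = E_{Q_t^K}[log R_t^K]`. -/
noncomputable def L {dz : ℕ} (pz : (t : ℕ) → Traj dz t → ℝ) (pX : ℕ → ℝ)
    (q : (t : ℕ) → (Fin t → Zsp dz) → Zsp dz → ℝ) (t K : ℕ) : ℝ :=
  ∫ zs, Real.log (R pz q t K zs) ∂(QK pz pX q t K)

/-- The Monte Carlo filtering objective `L_MCFO^K = ∑_{t=1}^T L_t^K`. -/
noncomputable def LMCFO {dz : ℕ} (pz : (t : ℕ) → Traj dz t → ℝ) (pX : ℕ → ℝ)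
    (q : (t : ℕ) → (Fin t → Zsp dz) → Zsp dz → ℝ) (T K : ℕ) : ℝ :=
  ∑ t ∈ Finset.range T, L pz pX q t K

/-- The conditional marginal likelihood `p(x_t | x_{1:t-1})` (with `p(x_1 | x_{1:0}) = p(x_1)`). -/
noncomputable def pcond (pX : ℕ → ℝ) : ℕ → ℝ
  | 0 => pX 0
  | t + 1 => pX (t + 1) / pX t

/-- With the optimal proposal the sampling density is the filtering posterior density. -/
theorem Qdens_eq_div {dz : ℕ} {pz : (t : ℕ) → Traj dz t → ℝ} {pX : ℕ → ℝ}
    {q : (t : ℕ) → (Fin t → Zsp dz) → Zsp dz → ℝ}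
    (hpz_nonneg : ∀ t z, 0 ≤ pz t z) (hpX_pos : ∀ t, 0 < pX t)
    (hsupp : ∀ t (z : Traj dz (t + 1)), pz t (Fin.init z) = 0 → pz (t + 1) z = 0)
    (hq0 : ∀ ζ : Zsp dz, q 0 Fin.elim0 ζ = pz 0 ![ζ] / pX 0)
    (hqopt : ∀ (t : ℕ) (h : Traj dz t) (ζ : Zsp dz), 0 < pz t h / pX t →
      q (t + 1) h ζ = (pz (t + 1) (Fin.snoc h ζ) / pX (t + 1)) / (pz t h / pX t))
    (t : ℕ) (z : Traj dz t) : Qdens pz pX q t z = pz t z / pX t := by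
  cases t with
  | zero =>
    have hz : ![z 0] = z := by
      ext i
      rw [Subsingleton.elim i 0]
      rfl
    simp only [Qdens, hq0, hz]
  | succ t =>
    rcases (hpz_nonneg t (Fin.init z)).eq_or_lt with h | h
    · simp [Qdens, ← h, hsupp t z h.symm]
    · have hpos : 0 < pz t (Fin.init z) / pX t := div_pos h (hpX_pos t)
      have hq := hqopt t (Fin.init z) (z (Fin.last (t + 1))) hpos
      rw [Fin.snoc_init_self] at hq
      simp only [Qdens, hq]
      exact mul_div_cancel₀ _ hpos.ne'

/-- Where the joint density is nonzero and the sampling density is the filtering posterior density,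
the importance weight is the conditional marginal likelihood. -/
theorem w_eq_pcond {dz : ℕ} {pz : (t : ℕ) → Traj dz t → ℝ} {pX : ℕ → ℝ}
    {q : (t : ℕ) → (Fin t → Zsp dz) → Zsp dz → ℝ} (hpX_pos : ∀ t, 0 < pX t)
    {t : ℕ} {z : Traj dz t} (hz : pz t z ≠ 0)
    (hQ : Qdens pz pX q t z = pz t z / pX t) : w pz q t z = pcond pX t := by
  have hne : pX t ≠ 0 := (hpX_pos t).ne'
  cases t with
  | zero =>
    simp only [Qdens] at hQ
    simp only [w, pcond, hQ]
    field_simp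
  | succ t =>
    have hne' : pX t ≠ 0 := (hpX_pos t).ne'
    have hprod : pz t (Fin.init z) * q (t + 1) (Fin.init z) (z (Fin.last (t + 1)))
        = pz (t + 1) z / pX (t + 1) * pX t := by
      rw [← hQ]
      simp only [Qdens]
      field_simp
    simp only [w, pcond, hprod]
    field_simp

/-- Normalising a nonnegative density `f` by its positive integral defines a probability measure. -/
theorem isProbabilityMeasure_withDensity_div_integral {α : Type*} [MeasurableSpace α]
    {μ : Measure α} {f : α → ℝ} (hf : ∀ x, 0 ≤ f x) (hpos : 0 < ∫ x, f x ∂μ) :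
    IsProbabilityMeasure (μ.withDensity fun x => ENNReal.ofReal (f x / ∫ y, f y ∂μ)) := by
  have hi : Integrable f μ := by
    by_contra h
    exact hpos.ne' (integral_undef h)
  refine ⟨?_⟩
  rw [withDensity_apply _ MeasurableSet.univ, Measure.restrict_univ, ← ofReal_integral_eq_lintegral_ofReal (hi.div_const _)
    (Eventually.of_forall fun x => div_nonneg (hf x) hpos.le), integral_div,
    div_self hpos.ne', ENNReal.ofReal_one]

/-- The conditional likelihoods telescope to the joint likelihood. -/
theorem sum_log_pcond {pX : ℕ → ℝ} (hpX_pos : ∀ t, 0 < pX t) (n : ℕ) :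
    ∑ t ∈ Finset.range (n + 1), Real.log (pcond pX t) = Real.log (pX n) := by
  induction n with
  | zero => simp [pcond]
  | succ n ih =>
    rw [Finset.sum_range_succ, ih]
    simp only [pcond]
    rw [Real.log_div (hpX_pos _).ne' (hpX_pos _).ne']
    ring

/-- If the weights are almost surely equal to a constant, then the Monte Carlo objective is the logarithm of that constant. -/
theorem L_eq_log_of_ae_const {dz : ℕ} {pz : (t : ℕ) → Traj dz t → ℝ} {pX : ℕ → ℝ}
    {q : (t : ℕ) → (Fin t → Zsp dz) → Zsp dz → ℝ} {t K : ℕ} {c : ℝ} (hK : 1 ≤ K)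
    [IsProbabilityMeasure (Q1 pz pX q t)] (hw : ∀ᵐ z ∂(Q1 pz pX q t), w pz q t z = c) :
    L pz pX q t K = Real.log c := by
  have hK0 : (K : ℝ) ≠ 0 := Nat.cast_ne_zero.mpr (by omega)
  have hall : ∀ᵐ zs ∂(QK pz pX q t K), ∀ i, w pz q t (zs i) = c :=
    ae_all_iff.mpr fun i =>
      (Measure.tendsto_eval_ae_ae (μ := fun _ : Fin K => Q1 pz pX q t) (i := i)).eventually hw
  have hlog : (fun zs => Real.log (R pz q t K zs)) =ᵐ[QK pz pX q t K] fun _ => Real.log c := by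
    filter_upwards [hall] with zs hzs
    simp [R, hzs, mul_div_cancel_left₀ _ hK0]
  have : IsProbabilityMeasure (QK pz pX q t K) := by unfold QK; infer_instance
  rw [L, integral_congr_ae hlog]
  simp

/-- Proposition 2, Optimal importance proposals: under the filtering
consistency condition, if the proposals are the one-step posterior ratios
`q(z_1|x_1) = p(z_1|x_1)` and `q(z_t|z_{1:t-1},x_{1:t}) = p(z_{1:t}|x_{1:t})/p(z_{1:t-1}|x_{1:t-1})`,
then every importance weight is a.s. constant equal to `p(x_t|x_{1:t-1})`, every term of the
objective satisfies `L_t^K = log p(x_t|x_{1:t-1})`, and `L_MCFO^K = log p(x_{1:T})` for every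
`K ≥ 1`: the bound is exact. -/
theorem optimal_proposal_exact {dz T : ℕ} (hdz : 1 ≤ dz) (hT : 1 ≤ T)
    (pz : (t : ℕ) → Traj dz t → ℝ) (pX : ℕ → ℝ)
    (q : (t : ℕ) → (Fin t → Zsp dz) → Zsp dz → ℝ)
    (hpz_meas : ∀ t, Measurable (pz t))
    (hpz_nonneg : ∀ t z, 0 ≤ pz t z)
    (hq_meas : ∀ t, Measurable (Function.uncurry (q t)))
    (hq_nonneg : ∀ t h ζ, 0 ≤ q t h ζ)
    (hq_prob : ∀ t h, ∫ ζ, q t h ζ = 1)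
    (hpX : ∀ t, pX t = ∫ z, pz t z)
    (hpX_pos : ∀ t, 0 < pX t)
    (hsupp : ∀ t (z : Traj dz (t + 1)), pz t (Fin.init z) = 0 → pz (t + 1) z = 0)
    (hint : ∀ t K, Integrable (fun zs => Real.log (R pz q t K zs)) (QK pz pX q t K))
    (hfilt : ∀ t : ℕ, ∀ᵐ h ∂(volume : Measure (Traj dz t)),
      (∫ ζ, pz (t + 1) (Fin.snoc h ζ) / pX (t + 1)) = pz t h / pX t)
    (hq0 : ∀ ζ : Zsp dz, q 0 Fin.elim0 ζ = pz 0 ![ζ] / pX 0)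
    (hqopt : ∀ (t : ℕ) (h : Traj dz t) (ζ : Zsp dz), 0 < pz t h / pX t →
      q (t + 1) h ζ = (pz (t + 1) (Fin.snoc h ζ) / pX (t + 1)) / (pz t h / pX t)) :
    (∀ t < T, ∀ᵐ z ∂(Q1 pz pX q t), w pz q t z = pcond pX t) ∧
    (∀ t < T, ∀ K, 1 ≤ K → L pz pX q t K = Real.log (pcond pX t)) ∧
    (∀ K, 1 ≤ K → LMCFO pz pX q T K = Real.log (pX (T - 1))) := by
  have hQ := Qdens_eq_div hpz_nonneg hpX_pos hsupp hq0 hqopt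
  have hQ1 : ∀ t, Q1 pz pX q t =
      volume.withDensity fun z => ENNReal.ofReal (pz t z / pX t) := fun t => by
    simp only [Q1, hQ]
  have hprob : ∀ t, IsProbabilityMeasure (Q1 pz pX q t) := fun t => by
    rw [hQ1, hpX]
    exact isProbabilityMeasure_withDensity_div_integral (hpz_nonneg t) (hpX t ▸ hpX_pos t)
  have hw : ∀ t, ∀ᵐ z ∂(Q1 pz pX q t), w pz q t z = pcond pX t := fun t => by
    rw [hQ1, ae_withDensity_iff ((hpz_meas t).div_const _).ennreal_ofReal]
    refine Eventually.of_forall fun z hz => w_eq_pcond hpX_pos ?_ (hQ t z)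
    intro h
    simp [h] at hz
  have hL : ∀ t K, 1 ≤ K → L pz pX q t K = Real.log (pcond pX t) := fun t K hK =>
    L_eq_log_of_ae_const hK (hw t)
  refine ⟨fun t _ => hw t, fun t _ K hK => hL t K hK, fun K hK => ?_⟩
  obtain ⟨n, rfl⟩ := Nat.exists_eq_add_of_le' hT
  simp only [LMCFO, hL _ K hK]
  exact sum_log_pcond hpX_pos n

end MCFO
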